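/- Let α and β be Jordan curves whose images intersect in at most two points, each intersection point being a crossing. Then α and β are non-piercing. Consequently, every finite family of Jordan curves in general position in which any two curves intersect in at most two points (a family of pseudocircles) is a non-piercing family. -/

import Mathlib

noncomputable section

open Set Metric

abbrev Plane : Type := EuclideanSpace ℝ (Fin 2)

/-- The unit circle `S¹ ⊆ ℝ²`. -/
def unitCircle : Set Plane := Metric.sphere 0 1

/-- A Jordan curve: a continuous injective map from the unit circle to the plane. -/
structure JordanCurve : Type where
  toFun : unitCircle → Plane
  continuous : Continuous toFun
  injective : Function.Injective toFun

/-- The image of a Jordan curve. -/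
def JordanCurve.img (γ : JordanCurve) : Set Plane := Set.range γ.toFun

/-- The inside of (the image of) a map from the circle to the plane: the union of the
bounded connected components of the complement of its image. -/
def insideFun (f : unitCircle → Plane) : Set Plane :=
  {p | p ∉ Set.range f ∧ Bornology.IsBounded (connectedComponentIn (Set.range f)ᶜ p)}

/-- The inside of a Jordan curve. -/
def JordanCurve.inside (γ : JordanCurve) : Set Plane := insideFun γ.toFun

/-- Path-connectedness of a set (trivially true for the empty set). -/
def PathConn (s : Set Plane) : Prop := ∀ x ∈ s, ∀ y ∈ s, JoinedIn s x y

/-- Two Jordan curves are non-piercing if each inside minus the other is path-connected. -/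
def NonPiercing (α β : JordanCurve) : Prop :=
  PathConn (α.inside \ β.inside) ∧ PathConn (β.inside \ α.inside)

/-- A family of Jordan curves is non-piercing if its members are pairwise non-piercing. -/
def NonPiercingFamily (Γ : Set JordanCurve) : Prop :=
  ∀ α ∈ Γ, ∀ β ∈ Γ, α ≠ β → NonPiercing α β

/-- An intersection point `p` of two Jordan curves is a crossing: every neighbourhood of `p`
contains points of each curve inside the other, and points of each curve outside the closure
of the inside of the other. -/
def IsCrossing (α β : JordanCurve) (p : Plane) : Prop :=
  ∀ U ∈ nhds p,
    (∃ q ∈ U, q ∈ α.img ∧ q ∈ β.inside) ∧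
    (∃ q ∈ U, q ∈ α.img ∧ q ∉ closure β.inside) ∧
    (∃ q ∈ U, q ∈ β.img ∧ q ∈ α.inside) ∧
    (∃ q ∈ U, q ∈ β.img ∧ q ∉ closure α.inside)

/-- A finite family of Jordan curves is in general position: pairwise finite intersections,
all intersection points are crossings, and no point lies on three curves. -/
def GeneralPosition (Γ : Set JordanCurve) : Prop :=
  (∀ α ∈ Γ, ∀ β ∈ Γ, α ≠ β → (α.img ∩ β.img).Finite) ∧
  (∀ α ∈ Γ, ∀ β ∈ Γ, α ≠ β → ∀ p ∈ α.img ∩ β.img, IsCrossing α β p) ∧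
  (∀ α ∈ Γ, ∀ β ∈ Γ, ∀ δ ∈ Γ, ∀ p : Plane,
      p ∈ α.img → p ∈ β.img → p ∈ δ.img → α = β ∨ β = δ ∨ α = δ)

/-! ### Continuous logarithms -/

/-- A nowhere vanishing continuous function on a simply connected space has a continuous
logarithm. -/
theorem exists_continuous_log {X : Type*} [TopologicalSpace X] [SimplyConnectedSpace X]
    [LocallyPathConnectedSpace X] (f : X → ℂ) (hf : Continuous f) (h0 : ∀ x, f x ≠ 0) :
    ∃ L : X → ℂ, Continuous L ∧ ∀ x, Complex.exp (L x) = f x := by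
  obtain ⟨x₀⟩ : Nonempty X := inferInstance
  obtain ⟨F, ⟨-, hF⟩, -⟩ := Complex.isCoveringMapOn_exp.existsUnique_continuousMap_lifts
    ⟨f, hf⟩ (a₀ := x₀) (Complex.exp_log (h0 x₀)) h0
  exact ⟨F, F.continuous, fun x => congrFun hF x⟩

/-- A continuous real-parameter function whose exponential is constant is constant. -/
theorem eq_of_exp_const (F : ℝ → ℂ) (hF : Continuous F) (c : ℂ)
    (h : ∀ t, Complex.exp (F t) = c) (s t : ℝ) : F s = F t := by
  have hc : c ≠ 0 := h t ▸ Complex.exp_ne_zero _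
  have key := (Complex.isCoveringMapOn_exp.existsUnique_continuousMap_lifts
    (ContinuousMap.const ℝ c) (a₀ := t) (e₀ := F t) (h t) (fun _ => hc)).unique
    (y₁ := ⟨F, hF⟩) (y₂ := ContinuousMap.const ℝ (F t)) ⟨rfl, funext h⟩
    ⟨rfl, funext fun _ => h t⟩
  exact DFunLike.congr_fun key s

/-- A logarithm of a nowhere vanishing function on the circle exists along the universal cover,
and its increment over a period is an integer multiple of `2πi`. -/
theorem exists_log_addCircle (f : AddCircle (2 * Real.pi) → ℂ) (hf : Continuous f)
    (h0 : ∀ x, f x ≠ 0) :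
    ∃ (n : ℤ) (L : ℝ → ℂ), Continuous L ∧ (∀ t : ℝ, Complex.exp (L t) = f t) ∧
      ∀ t, L (t + 2 * Real.pi) = L t + n * (2 * Real.pi * Complex.I) := by
  obtain ⟨L, hL, hexp⟩ := exists_continuous_log (fun t : ℝ => f t)
    (hf.comp (AddCircle.continuous_mk' _)) (fun t => h0 _)
  have hper : ∀ t : ℝ, Complex.exp (L (t + 2 * Real.pi) - L t) = 1 := by
    intro t
    rw [Complex.exp_sub, hexp, hexp, AddCircle.coe_add_period, div_self (h0 _)]
  obtain ⟨n, hn⟩ := Complex.exp_eq_one_iff.1 (hper 0)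
  refine ⟨n, L, hL, hexp, fun t => ?_⟩
  have := eq_of_exp_const (fun t => L (t + 2 * Real.pi) - L t) (by fun_prop) 1 hper t 0
  simp only [hn] at this
  rw [← this]; ring

/-- Two nowhere vanishing functions on the circle are multiplicatively dependent modulo
exponentials. -/
theorem exists_zpow_eq_zpow_mul_exp (f g : AddCircle (2 * Real.pi) → ℂ)
    (hf : Continuous f) (hg : Continuous g) (hf0 : ∀ x, f x ≠ 0) (hg0 : ∀ x, g x ≠ 0) :
    ∃ (m n : ℤ) (G : AddCircle (2 * Real.pi) → ℂ), Continuous G ∧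
      (∀ x, f x ^ m = g x ^ n * Complex.exp (G x)) ∧ (m ≠ 0 ∨ n ≠ 0) := by
  have descend : ∀ M : ℝ → ℂ, Continuous M → Function.Periodic M (2 * Real.pi) →
      ∃ G : AddCircle (2 * Real.pi) → ℂ, Continuous G ∧ ∀ t : ℝ, G t = M t :=
    fun M hM hper => ⟨hper.lift, continuous_quot_lift _ hM, fun t => hper.lift_coe t⟩
  obtain ⟨a, A, hA, hAexp, hAper⟩ := exists_log_addCircle f hf hf0
  obtain ⟨b, B, hB, hBexp, hBper⟩ := exists_log_addCircle g hg hg0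
  by_cases hb : b = 0
  · obtain ⟨G, hG, hGB⟩ := descend (fun t => -B t) (by fun_prop)
      (fun t => by simp [hBper, hb])
    refine ⟨0, 1, G, hG, fun x => ?_, by simp⟩
    induction x using QuotientAddGroup.induction_on with
    | H t =>
      rw [hGB, ← hBexp, zpow_one, zpow_zero, ← Complex.exp_add]
      simp
  · obtain ⟨G, hG, hGM⟩ := descend (fun t => b * A t - a * B t) (by fun_prop)
      (fun t => by simp only [hAper, hBper]; ring)
    refine ⟨b, a, G, hG, fun x => ?_, Or.inl hb⟩
    induction x using QuotientAddGroup.induction_on with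
    | H t =>
      rw [hGM, ← hBexp, ← hAexp, ← Complex.exp_int_mul, ← Complex.exp_int_mul, ← Complex.exp_add]
      congr 1; ring

/-! ### Identifications with the complex numbers -/

/-- The standard isometry between `ℂ` and the plane. -/
def planeEquiv : ℂ ≃ₗᵢ[ℝ] Plane := Complex.orthonormalBasisOneI.repr

/-- The unit circle of the plane as the unit circle of `ℂ`. -/
def circleHomeo : Circle ≃ₜ unitCircle where
  toFun z := ⟨planeEquiv z, by simp [unitCircle, Circle.norm_coe]⟩
  invFun x := ⟨planeEquiv.symm x.1, by
    have := x.2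
    simp only [unitCircle, mem_sphere_iff_norm, sub_zero] at this
    simp [Submonoid.unitSphere, this]⟩
  left_inv z := by ext; simp
  right_inv x := by ext; simp
  continuous_toFun := by
    refine Continuous.subtype_mk ?_ _
    exact planeEquiv.continuous.comp continuous_subtype_val
  continuous_invFun := by
    refine Continuous.subtype_mk ?_ _
    exact planeEquiv.symm.continuous.comp continuous_subtype_val

/-- The unit circle parametrised by angles. -/
def angleHomeo : AddCircle (2 * Real.pi) ≃ₜ unitCircle :=
  AddCircle.homeomorphCircle'.trans circleHomeo

/-- The complex coordinate of `z` relative to `p`. -/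
def offset (p z : Plane) : ℂ := planeEquiv.symm z - planeEquiv.symm p

theorem continuous_offset (p : Plane) : Continuous (offset p) :=
  planeEquiv.symm.continuous.sub continuous_const

theorem offset_ne_zero {p z : Plane} (h : z ≠ p) : offset p z ≠ 0 :=
  sub_ne_zero.2 fun h' => h (planeEquiv.symm.injective h')

instance : CompactSpace unitCircle := isCompact_iff_compactSpace.1 (isCompact_sphere _ _)

namespace JordanCurve

variable (γ : JordanCurve)

theorem isClosed_img : IsClosed γ.img := (isCompact_range γ.continuous).isClosed

theorem isClosedEmbedding : Topology.IsClosedEmbedding γ.toFun :=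
  γ.continuous.isClosedEmbedding γ.injective

theorem mem_inside_of_preconnected {s : Set Plane} (hs : IsPreconnected s)
    (hd : s ⊆ γ.imgᶜ) {x y : Plane} (hx : x ∈ s) (hy : y ∈ s) (h : x ∈ γ.inside) :
    y ∈ γ.inside := by
  have hyc : y ∈ connectedComponentIn γ.imgᶜ x := hs.subset_connectedComponentIn hx hd hy
  refine ⟨hd hy, ?_⟩
  change Bornology.IsBounded (connectedComponentIn γ.imgᶜ y)
  rw [← connectedComponentIn_eq hyc]
  exact h.2

end JordanCurve

theorem frontier_connectedComponentIn_subset {X : Type*} [TopologicalSpace X]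
    [LocallyConnectedSpace X] {F : Set X} (hF : IsOpen F) (x : X) :
    frontier (connectedComponentIn F x) ⊆ Fᶜ := by
  intro z hz hzF
  have hU := hF.connectedComponentIn (x := x)
  have hV := hF.connectedComponentIn (x := z)
  obtain ⟨w, hwV, hwU⟩ := mem_closure_iff.1 hz.1 _ hV (mem_connectedComponentIn hzF)
  have : z ∈ connectedComponentIn F x := by
    rw [connectedComponentIn_eq hwU, ← connectedComponentIn_eq hwV]
    exact mem_connectedComponentIn hzF
  exact hz.2 (hU.interior_eq.symm ▸ this)

/-- If `p` lies in a bounded complementary component not containing `q`, no nontrivial power of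
`z - p` equals a power of `z - q` times an exponential on the curve. -/
theorem zpow_offset_not_dependent (γ : JordanCurve) {p q : Plane} (hp : p ∈ γ.inside)
    (hqK : q ∉ γ.img) (hq : q ∉ connectedComponentIn γ.imgᶜ p) {m : ℤ} (hm : m ≠ 0) (n : ℤ)
    (G : unitCircle → ℂ) (hG : Continuous G) (h : ∀ x, offset p (γ.toFun x) ^ m =
      offset q (γ.toFun x) ^ n * Complex.exp (G x)) : False := by
  obtain ⟨hpK, hbdd⟩ := hp
  change Bornology.IsBounded (connectedComponentIn γ.imgᶜ p) at hbdd
  set U := connectedComponentIn γ.imgᶜ p with hUdef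
  have hpU : p ∈ U := mem_connectedComponentIn hpK
  have hKo : IsOpen γ.imgᶜ := γ.isClosed_img.isOpen_compl
  have hUo : IsOpen U := hKo.connectedComponentIn
  have hfr : frontier U ⊆ γ.img := fun z hz => by
    simpa using frontier_connectedComponentIn_subset hKo p hz
  have hqcl : q ∉ closure U := by
    rw [closure_eq_self_union_frontier]
    exact fun h' => h'.elim hq fun h'' => hqK (hfr h'')
  obtain ⟨g, hg⟩ := ContinuousMap.exists_extension' γ.isClosedEmbedding ⟨G, hG⟩
  classical
  let H : Plane → ℂ := U.piecewise (fun z => offset q z ^ n * Complex.exp (g z))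
    (fun z => offset p z ^ m)
  have hHc : Continuous H := by
    refine continuous_piecewise ?_ ?_ ?_
    · intro z hz
      obtain ⟨x, rfl⟩ := hfr hz
      have : g (γ.toFun x) = G x := congrFun hg x
      simp only [this, h]
    · refine ContinuousOn.mul ?_ (by fun_prop)
      refine (continuous_offset q).continuousOn.zpow₀ n fun z hz => Or.inl (offset_ne_zero ?_)
      rintro rfl; exact hqcl hz
    · rw [hUo.isClosed_compl.closure_eq]
      refine (continuous_offset p).continuousOn.zpow₀ m fun z hz => Or.inl (offset_ne_zero ?_)
      rintro rfl; exact hz hpU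
  have hH0 : ∀ z, H z ≠ 0 := by
    intro z
    by_cases hz : z ∈ U
    · simp only [H, piecewise_eq_of_mem _ _ _ hz]
      refine mul_ne_zero (zpow_ne_zero _ (offset_ne_zero ?_)) (Complex.exp_ne_zero _)
      rintro rfl; exact hq hz
    · simp only [H, piecewise_eq_of_notMem _ _ _ hz]
      refine zpow_ne_zero _ (offset_ne_zero ?_)
      rintro rfl; exact hz hpU
  obtain ⟨L, hL, hexp⟩ := exists_continuous_log H hHc hH0
  obtain ⟨R, hR0, hR⟩ := hbdd.subset_ball_lt 0 p
  let c : ℝ → Plane := fun t => p + planeEquiv (R * Complex.exp (t * Complex.I))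
  have hc : Continuous c :=
    continuous_const.add (planeEquiv.continuous.comp (by fun_prop))
  have hoff : ∀ t, offset p (c t) = R * Complex.exp (t * Complex.I) := by
    intro t; simp [offset, c]
  have hcU : ∀ t, c t ∉ U := by
    intro t ht
    have := hR ht
    simp [c, Complex.norm_exp_ofReal_mul_I, abs_of_pos hR0] at this
  have key := eq_of_exp_const (fun t => L (c t) - m * (t * Complex.I)) (by fun_prop)
    ((R : ℂ) ^ m) (fun t => by
      rw [Complex.exp_sub, hexp, Complex.exp_int_mul]
      simp only [H, piecewise_eq_of_notMem _ _ _ (hcU t), hoff, mul_zpow]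
      exact mul_div_cancel_right₀ _ (zpow_ne_zero _ (Complex.exp_ne_zero _))) (2 * Real.pi) 0
  have hcc : c (2 * Real.pi) = c 0 := by
    simp [c, Complex.exp_two_pi_mul_I]
  simp [hcc, hm, Real.pi_ne_zero, Complex.I_ne_zero] at key

/-- The complement of a Jordan curve has at most one bounded component. -/
theorem JordanCurve.mem_connectedComponentIn_of_mem_inside (γ : JordanCurve) {p q : Plane}
    (hp : p ∈ γ.inside) (hq : q ∈ γ.inside) : q ∈ connectedComponentIn γ.imgᶜ p := by
  by_contra hqp
  have hpq : p ∉ connectedComponentIn γ.imgᶜ q := by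
    intro h
    rw [← connectedComponentIn_eq h] at hqp
    exact hqp (mem_connectedComponentIn hq.1)
  have hcont : Continuous fun x => γ.toFun (angleHomeo x) :=
    γ.continuous.comp angleHomeo.continuous
  have hne : ∀ r ∈ γ.inside, ∀ x, offset r (γ.toFun (angleHomeo x)) ≠ 0 :=
    fun r hr x => offset_ne_zero fun h => hr.1 ⟨_, h⟩
  obtain ⟨m, n, G, hG, hdep, hmn⟩ := exists_zpow_eq_zpow_mul_exp
    (fun x => offset p (γ.toFun (angleHomeo x))) (fun x => offset q (γ.toFun (angleHomeo x)))
    ((continuous_offset p).comp hcont) ((continuous_offset q).comp hcont) (hne p hp) (hne q hq)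
  have hdep' : ∀ y, offset p (γ.toFun y) ^ m =
      offset q (γ.toFun y) ^ n * Complex.exp (G (angleHomeo.symm y)) := by
    intro y
    simpa using hdep (angleHomeo.symm y)
  have hG' : Continuous fun y => G (angleHomeo.symm y) := hG.comp angleHomeo.symm.continuous
  rcases hmn with hm | hn
  · exact zpow_offset_not_dependent γ hp hq.1 hqp hm n _ hG' hdep'
  · refine zpow_offset_not_dependent γ hq hp.1 hpq hn m _ hG'.neg fun y => ?_
    rw [hdep', mul_assoc, ← Complex.exp_add]
    simp

theorem JordanCurve.pathConn_inside (γ : JordanCurve) : PathConn γ.inside := by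
  intro x hx y hy
  have hKo : IsOpen γ.imgᶜ := γ.isClosed_img.isOpen_compl
  have hpc : IsPathConnected (connectedComponentIn γ.imgᶜ x) :=
    hKo.connectedComponentIn.isConnected_iff_isPathConnected.1
      (isConnected_connectedComponentIn_iff.2 hx.1)
  refine (hpc.joinedIn x (mem_connectedComponentIn hx.1) y
    (γ.mem_connectedComponentIn_of_mem_inside hx hy)).mono fun z hz => ?_
  exact γ.mem_inside_of_preconnected isPreconnected_connectedComponentIn
    (connectedComponentIn_subset _ _) (mem_connectedComponentIn hx.1) hz hx

/-! ### Pairs of curves -/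

/-- Following a path up to its first visit to a closed set. -/
theorem Path.exists_first_hit {X : Type*} [TopologicalSpace X] {x y : X} (γ : Path x y)
    {K : Set X} (hK : IsClosed K) (hy : y ∈ K) :
    ∃ T : unitInterval, γ T ∈ K ∧ ∀ t < T, γ t ∉ K := by
  have hcl : IsClosed (γ ⁻¹' K) := hK.preimage γ.continuous
  obtain ⟨T, hT, hmin⟩ := hcl.isCompact.exists_isLeast ⟨1, by simpa using hy⟩
  exact ⟨T, hT, fun t ht htK => (hmin htK).not_gt ht⟩

theorem JordanCurve.exists_joinedIn_img (α β : JordanCurve) {x y : Plane}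
    (hx : x ∈ α.inside \ β.inside) (hy : y ∈ β.img ∩ α.inside) :
    ∃ z ∈ β.img ∩ α.inside, JoinedIn (α.inside \ β.inside) x z := by
  obtain ⟨γ, hγ⟩ := α.pathConn_inside x hx.1 y hy.2
  obtain ⟨T, hT, hlt⟩ := γ.exists_first_hit β.isClosed_img hy.1
  refine ⟨γ T, ⟨hT, hγ T⟩, ?_⟩
  have hsub : ∀ t ≤ T, γ t ∈ α.inside \ β.inside := by
    intro t ht
    refine ⟨hγ t, fun hin => ?_⟩
    rcases ht.eq_or_lt with rfl | ht
    · exact hin.1 hT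
    · have hconn : IsPreconnected (γ '' Icc 0 t) :=
        isPreconnected_Icc.image _ γ.continuous.continuousOn
      refine hx.2 (β.mem_inside_of_preconnected hconn ?_ ⟨t, ⟨t.2.1, le_rfl⟩, rfl⟩
        ⟨0, ⟨le_rfl, t.2.1⟩, γ.source⟩ hin)
      rintro _ ⟨s, hs, rfl⟩
      exact hlt s (hs.2.trans_lt ht)
  have hj : JoinedIn (α.inside \ β.inside) (γ 0) (γ T) := by
    refine ⟨γ.subpath 0 T, fun t => ?_⟩
    have ht := mem_range_self (f := γ.subpath 0 T) t
    rw [Path.range_subpath_of_le γ 0 T T.2.1] at ht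
    obtain ⟨u, hu, hut⟩ := ht
    exact hut ▸ hsub u hu.2
  rwa [γ.source] at hj

theorem pathConn_inside_diff (α β : JordanCurve) (h : PathConn (β.img ∩ α.inside)) :
    PathConn (α.inside \ β.inside) := by
  intro x hx y hy
  by_cases hne : (β.img ∩ α.inside).Nonempty
  · obtain ⟨w, hw⟩ := hne
    obtain ⟨x', hx', hjx⟩ := α.exists_joinedIn_img β hx hw
    obtain ⟨y', hy', hjy⟩ := α.exists_joinedIn_img β hy hw
    exact (hjx.trans ((h x' hx' y' hy').mono fun z hz => ⟨hz.2, fun hz' => hz'.1 hz.1⟩)).trans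
      hjy.symm
  · obtain ⟨γ, hγ⟩ := α.pathConn_inside x hx.1 y hy.1
    refine ⟨γ, fun t => ⟨hγ t, fun hin => hx.2 ?_⟩⟩
    refine β.mem_inside_of_preconnected (isPreconnected_range γ.continuous) ?_
      (mem_range_self t) ⟨0, γ.source⟩ hin
    rintro _ ⟨s, rfl⟩ hs
    exact hne ⟨_, hs, hγ s⟩

theorem IsCrossing.symm {α β : JordanCurve} {p : Plane} (h : IsCrossing α β p) :
    IsCrossing β α p := fun U hU =>
  ⟨(h U hU).2.2.1, (h U hU).2.2.2, (h U hU).1, (h U hU).2.1⟩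

/-- A Jordan curve parametrised by angle. -/
def JordanCurve.param (γ : JordanCurve) (t : ℝ) : Plane :=
  γ.toFun (angleHomeo (t : AddCircle (2 * Real.pi)))

namespace JordanCurve

variable (γ : JordanCurve)

theorem continuous_param : Continuous γ.param :=
  γ.continuous.comp (angleHomeo.continuous.comp (AddCircle.continuous_mk' _))

theorem param_mem (t : ℝ) : γ.param t ∈ γ.img := mem_range_self _

theorem injOn_param (a : ℝ) : InjOn γ.param (Ico a (a + 2 * Real.pi)) := by
  have : Fact (0 < 2 * Real.pi) := ⟨Real.two_pi_pos⟩
  intro s hs t ht h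
  exact (AddCircle.coe_eq_coe_iff_of_mem_Ico hs ht).1 (angleHomeo.injective (γ.injective h))

theorem exists_param_eq (a : ℝ) {x : Plane} (hx : x ∈ γ.img) :
    ∃ t ∈ Ico a (a + 2 * Real.pi), γ.param t = x := by
  have : Fact (0 < 2 * Real.pi) := ⟨Real.two_pi_pos⟩
  obtain ⟨u, rfl⟩ := hx
  have : angleHomeo.symm u ∈ (univ : Set (AddCircle (2 * Real.pi))) := mem_univ _
  rw [← AddCircle.coe_image_Ico_eq (2 * Real.pi) a] at this
  obtain ⟨t, ht, htu⟩ := this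
  exact ⟨t, ht, by simp [param, htu]⟩

theorem mem_inside_of_param_mem_inside (α β : JordanCurve) {S : Set ℝ} (hS : IsPreconnected S)
    (h : ∀ t ∈ S, β.param t ∉ α.img) {t₁ t₂ : ℝ} (h₁ : t₁ ∈ S) (h₂ : t₂ ∈ S)
    (hin : β.param t₁ ∈ α.inside) : β.param t₂ ∈ α.inside := by
  refine α.mem_inside_of_preconnected (hS.image _ β.continuous_param.continuousOn) ?_
    ⟨t₁, h₁, rfl⟩ ⟨t₂, h₂, rfl⟩ hin
  rintro _ ⟨t, ht, rfl⟩
  exact h t ht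

theorem joinedIn_of_param_mem_inside (α β : JordanCurve) {S : Set ℝ} (hS : Convex ℝ S)
    (h : ∀ t ∈ S, β.param t ∉ α.img) {t₁ t₂ : ℝ} (h₁ : t₁ ∈ S) (h₂ : t₂ ∈ S)
    (hin : β.param t₁ ∈ α.inside) :
    JoinedIn (β.img ∩ α.inside) (β.param t₁) (β.param t₂) := by
  refine (((hS.isPathConnected ⟨t₁, h₁⟩).image β.continuous_param).joinedIn _
    ⟨t₁, h₁, rfl⟩ _ ⟨t₂, h₂, rfl⟩).mono ?_
  rintro _ ⟨t, ht, rfl⟩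
  exact ⟨β.param_mem t, mem_inside_of_param_mem_inside α β hS.isPreconnected h h₁ ht hin⟩

/-- If two curves meet at `β.param a` and in at most one other point, then `β` is cut into at most
two arcs avoiding `α`. -/
theorem exists_arcs (α β : JordanCurve) (hcard : (α.img ∩ β.img).encard ≤ 2) {a : ℝ}
    (ha : β.param a ∈ α.img) :
    ∃ s ∈ Ioc a (a + 2 * Real.pi), β.param s ∈ α.img ∧
      (∀ t ∈ Ioo a s, β.param t ∉ α.img) ∧
      (∀ t ∈ Ioo s (a + 2 * Real.pi), β.param t ∉ α.img) := by
  have hpi := Real.two_pi_pos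
  by_cases hex : ∃ s ∈ Ioo a (a + 2 * Real.pi), β.param s ∈ α.img
  · obtain ⟨s, hs, hsα⟩ := hex
    have huniq : ∀ t ∈ Ioo a (a + 2 * Real.pi), t ≠ s → β.param t ∉ α.img := by
      intro t ht hts htα
      have ha' : a ∈ Ico a (a + 2 * Real.pi) := ⟨le_rfl, by linarith⟩
      have hs' : s ∈ Ico a (a + 2 * Real.pi) := ⟨hs.1.le, hs.2⟩
      have ht' : t ∈ Ico a (a + 2 * Real.pi) := ⟨ht.1.le, ht.2⟩
      have hthree : ({β.param a, β.param s, β.param t} : Set Plane).encard = 3 := by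
        refine Set.encard_eq_three.2 ⟨_, _, _, ?_, ?_, ?_, rfl⟩
        · exact fun h => hs.1.ne (β.injOn_param a ha' hs' h)
        · exact fun h => ht.1.ne (β.injOn_param a ha' ht' h)
        · exact fun h => hts (β.injOn_param a hs' ht' h).symm
      have hsub : ({β.param a, β.param s, β.param t} : Set Plane) ⊆ α.img ∩ β.img := by
        rintro _ (rfl | rfl | rfl)
        exacts [⟨ha, β.param_mem _⟩, ⟨hsα, β.param_mem _⟩, ⟨htα, β.param_mem _⟩]
      have hle := (Set.encard_le_encard hsub).trans hcard
      rw [hthree] at hle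
      exact absurd hle (by decide)
    exact ⟨s, ⟨hs.1, hs.2.le⟩, hsα, fun t ht => huniq t ⟨ht.1, ht.2.trans hs.2⟩ ht.2.ne,
      fun t ht => huniq t ⟨hs.1.trans ht.1, ht.2⟩ ht.1.ne'⟩
  · push Not at hex
    refine ⟨a + 2 * Real.pi, ⟨by linarith, le_rfl⟩, ?_, fun t ht => hex t ht,
      fun t ht => absurd (ht.1.trans ht.2) (lt_irrefl _)⟩
    simpa [param, AddCircle.coe_add_period] using ha

end JordanCurve

theorem pathConn_img_inter_inside (α β : JordanCurve) (hcard : (α.img ∩ β.img).encard ≤ 2)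
    (hcross : ∀ p ∈ α.img ∩ β.img, IsCrossing α β p) : PathConn (β.img ∩ α.inside) := by
  intro x hx y hy
  by_cases hne : ∃ p ∈ α.img, p ∈ β.img
  · obtain ⟨p, hpα, hpβ⟩ := hne
    obtain ⟨a, -, rfl⟩ := β.exists_param_eq 0 hpβ
    obtain ⟨s, hs, hsα, harc₁, harc₂⟩ := JordanCurve.exists_arcs α β hcard hpα
    have hmem : ∀ t ∈ Ico a (a + 2 * Real.pi), β.param t ∈ α.inside →
        t ∈ Ioo a s ∨ t ∈ Ioo s (a + 2 * Real.pi) := by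
      intro t ht hin
      have hta : t ≠ a := by rintro rfl; exact hin.1 hpα
      have hts : t ≠ s := by rintro rfl; exact hin.1 hsα
      rcases lt_or_gt_of_ne hts with h | h
      · exact Or.inl ⟨lt_of_le_of_ne ht.1 hta.symm, h⟩
      · exact Or.inr ⟨h, ht.2⟩
    have hnotboth : ∀ t₁ ∈ Ioo a s, ∀ t₂ ∈ Ioo s (a + 2 * Real.pi), β.param t₁ ∈ α.inside →
        β.param t₂ ∈ α.inside → False := by
      intro t₁ h₁ t₂ h₂ hin₁ hin₂
      obtain ⟨q, -, hqβ, hq⟩ := (hcross _ ⟨hpα, hpβ⟩ univ Filter.univ_mem).2.2.2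
      obtain ⟨t, ht, rfl⟩ := β.exists_param_eq a hqβ
      have himg : ∀ u ∈ Ioo a s ∪ Ioo s (a + 2 * Real.pi), β.param u ∈ α.inside := by
        rintro u (hu | hu)
        · exact JordanCurve.mem_inside_of_param_mem_inside α β isPreconnected_Ioo harc₁ h₁ hu hin₁
        · exact JordanCurve.mem_inside_of_param_mem_inside α β isPreconnected_Ioo harc₂ h₂ hu hin₂
      have htcl : t ∈ closure (Ioo a s ∪ Ioo s (a + 2 * Real.pi)) := by
        rw [closure_union, closure_Ioo hs.1.ne, closure_Ioo (h₂.1.trans h₂.2).ne,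
          Icc_union_Icc_eq_Icc hs.1.le hs.2]
        exact ⟨ht.1, ht.2.le⟩
      exact hq (map_mem_closure β.continuous_param htcl himg)
    obtain ⟨t₁, ht₁, rfl⟩ := β.exists_param_eq a hx.1
    obtain ⟨t₂, ht₂, rfl⟩ := β.exists_param_eq a hy.1
    rcases hmem t₁ ht₁ hx.2 with h₁ | h₁ <;> rcases hmem t₂ ht₂ hy.2 with h₂ | h₂
    · exact JordanCurve.joinedIn_of_param_mem_inside α β (convex_Ioo _ _) harc₁ h₁ h₂ hx.2
    · exact (hnotboth t₁ h₁ t₂ h₂ hx.2 hy.2).elim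
    · exact (hnotboth t₂ h₂ t₁ h₁ hy.2 hx.2).elim
    · exact JordanCurve.joinedIn_of_param_mem_inside α β (convex_Ioo _ _) harc₂ h₁ h₂ hx.2
  · push Not at hne
    obtain ⟨t₁, -, rfl⟩ := β.exists_param_eq 0 hx.1
    obtain ⟨t₂, -, rfl⟩ := β.exists_param_eq 0 hy.1
    exact JordanCurve.joinedIn_of_param_mem_inside α β convex_univ
      (fun t _ h => hne _ h (β.param_mem t)) (mem_univ _) (mem_univ _) hx.2

/-- Two Jordan curves crossing in at most two points are non-piercing; consequently every
finite family of pseudocircles in general position is a non-piercing family. -/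
theorem pseudocircles_are_nonpiercing :
    (∀ α β : JordanCurve, (α.img ∩ β.img).encard ≤ 2 →
        (∀ p ∈ α.img ∩ β.img, IsCrossing α β p) → NonPiercing α β) ∧
    (∀ Γ : Set JordanCurve, Γ.Finite → GeneralPosition Γ →
        (∀ α ∈ Γ, ∀ β ∈ Γ, α ≠ β → (α.img ∩ β.img).encard ≤ 2) →
        NonPiercingFamily Γ) := by
  have key : ∀ α β : JordanCurve, (α.img ∩ β.img).encard ≤ 2 →
      (∀ p ∈ α.img ∩ β.img, IsCrossing α β p) → NonPiercing α β := by
    intro α β hcard hcross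
    refine ⟨pathConn_inside_diff α β (pathConn_img_inter_inside α β hcard hcross),
      pathConn_inside_diff β α (pathConn_img_inter_inside β α (inter_comm _ _ ▸ hcard) ?_)⟩
    exact fun p hp => (hcross p hp.symm).symm
  exact ⟨key, fun Γ _ hgen hcard α hα β hβ hne =>
    key α β (hcard α hα β hβ hne) (hgen.2.1 α hα β hβ hne)⟩
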